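/- Let K be a compact metrizable group and Γ a group of continuous automorphisms of K. Then there exists a closed normal subgroup L of K which is invariant under every automorphism in the center Z(Γ) of the action, such that Γ is ergodic on L and the induced action of Γ on K/L is distal; moreover L is the largest such subgroup: every closed Γ-invariant subgroup H of K on which Γ is ergodic satisfies H ⊆ L. -/

import Mathlib

open MeasureTheory Topology Set

set_option linter.unusedVariables false

namespace ErgZd

variable {K : Type*}

/-- The group of bi-continuous automorphisms of a topological group,
as a subgroup of `MulAut K`. -/
def ContAut (K : Type*) [Group K] [TopologicalSpace K] : Subgroup (MulAut K) where
  carrier := {α | Continuous α ∧ Continuous α.symm}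
  one_mem' := ⟨continuous_id, continuous_id⟩
  mul_mem' := fun {a b} ha hb => ⟨ha.1.comp hb.1, hb.2.comp ha.2⟩
  inv_mem' := fun {a} ha => ⟨ha.2, ha.1⟩

section Defs

variable [Group K] [TopologicalSpace K]

lemma ContAut.continuous (α : ↥(ContAut K)) : Continuous ⇑(α : MulAut K) := α.2.1

lemma ContAut.continuous_symm (α : ↥(ContAut K)) :
    Continuous ⇑(α : MulAut K).symm := α.2.2

/-- Ergodicity of the action of a set `S` of automorphisms with respect to `μ`:
every invariant Borel set is null or conull. -/
def ErgSet [MeasurableSpace K] (μ : Measure K) (S : Set ↥(ContAut K)) : Prop :=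
  ∀ A : Set K, MeasurableSet A → (∀ α ∈ S, (α : MulAut K) '' A = A) → μ A = 0 ∨ μ A = 1

/-- Ergodicity of a single automorphism: ergodicity of the group of its integer powers. -/
def ErgAut [MeasurableSpace K] (μ : Measure K) (α : ↥(ContAut K)) : Prop :=
  ErgSet μ (Set.range fun n : ℤ => α ^ n)

/-- Distality of the action of a set of automorphisms: for `x ≠ 1`, the identity is
not in the closure of the orbit of `x`. -/
def DistalSet (S : Set ↥(ContAut K)) : Prop :=
  ∀ x : K, x ≠ 1 → (1 : K) ∉ closure ((fun α : ↥(ContAut K) => (α : MulAut K) x) '' S)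

/-- Distality of a single automorphism. -/
def DistalAut (α : ↥(ContAut K)) : Prop := DistalSet (Set.range fun n : ℤ => α ^ n)

/-- The descending chain condition for an action: every decreasing
sequence of closed invariant subgroups is eventually constant. -/
def HasDCC (S : Set ↥(ContAut K)) : Prop :=
  ∀ C : ℕ → Subgroup K, (∀ n, IsClosed (C n : Set K)) → (∀ n, C (n + 1) ≤ C n) →
    (∀ n, ∀ α ∈ S, ∀ x, x ∈ C n ↔ (α : MulAut K) x ∈ C n) → ∃ N, ∀ n, N ≤ n → C n = C N

/-- Restriction of an automorphism to an invariant subgroup. -/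
def restrictAut (H : Subgroup K) (α : ↥(ContAut K))
    (h : ∀ x, x ∈ H ↔ (α : MulAut K) x ∈ H) : ↥(ContAut ↥H) := by
  refine ⟨⟨⟨fun x => ⟨(α : MulAut K) x, (h x).mp x.2⟩,
      fun x => ⟨(α : MulAut K).symm x, (h _).mpr (by simpa using x.2)⟩, ?_, ?_⟩, ?_⟩, ?_, ?_⟩
  · intro x; ext; simp
  · intro x; ext; simp
  · intro x y; ext; simp
  · exact Continuous.subtype_mk ((ContAut.continuous α).comp continuous_subtype_val) _
  · exact Continuous.subtype_mk ((ContAut.continuous_symm α).comp continuous_subtype_val) _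

@[simp] lemma restrictAut_coe (H : Subgroup K) (α : ↥(ContAut K))
    (h : ∀ x, x ∈ H ↔ (α : MulAut K) x ∈ H) (x : ↥H) :
    ((((restrictAut H α h) : MulAut ↥H) x : ↥H) : K) = (α : MulAut K) (x : K) := rfl

/-- The automorphism induced on the quotient by an invariant closed normal subgroup. -/
def quotAut (N : Subgroup K) [N.Normal] (α : ↥(ContAut K))
    (h : ∀ x, x ∈ N ↔ (α : MulAut K) x ∈ N) : ↥(ContAut (K ⧸ N)) := by
  have hmap : N.map ((α : MulAut K) : K ≃* K) = N := by
    ext y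
    constructor
    · rintro ⟨x, hx, rfl⟩; exact (h x).mp hx
    · intro hy
      exact ⟨(α : MulAut K).symm y, (h _).mpr (by simpa using hy), by simp⟩
  refine ⟨QuotientGroup.congr N N ((α : MulAut K) : K ≃* K) hmap, ?_, ?_⟩
  · apply (QuotientGroup.isQuotientMap_mk N).continuous_iff.mpr
    have : ⇑(QuotientGroup.congr N N ((α : MulAut K) : K ≃* K) hmap) ∘ (QuotientGroup.mk : K → K ⧸ N)
        = (QuotientGroup.mk : K → K ⧸ N) ∘ ⇑(α : MulAut K) := by
      funext x
      exact QuotientGroup.congr_mk N N _ hmap x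
    rw [this]
    exact QuotientGroup.continuous_mk.comp (ContAut.continuous α)
  · apply (QuotientGroup.isQuotientMap_mk N).continuous_iff.mpr
    have : ⇑(QuotientGroup.congr N N ((α : MulAut K) : K ≃* K) hmap).symm ∘ (QuotientGroup.mk : K → K ⧸ N)
        = (QuotientGroup.mk : K → K ⧸ N) ∘ ⇑((α : MulAut K) : K ≃* K).symm := by
      funext x
      rfl
    rw [this]
    exact QuotientGroup.continuous_mk.comp (ContAut.continuous_symm α)

end Defs

open scoped Pointwise symmDiff

/-- Distality modulo a (not necessarily normal) subgroup `N`: for `x ∉ N`, the union of the cosets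
`α x N`, `α ∈ Γ`, stays away from the identity. -/
def DistalMod [Group K] [TopologicalSpace K] (Γ : Subgroup ↥(ContAut K)) (N : Subgroup K) : Prop :=
  ∀ x ∉ N, ∃ U ∈ 𝓝 (1 : K), ∀ α ∈ Γ, ∀ m ∈ N, (α : MulAut K) x * m ∉ U

section Distal

variable [Group K] [TopologicalSpace K] {Γ : Subgroup ↥(ContAut K)} {N : Subgroup K}

lemma mem_iff_of_forall_mem (h : ∀ α ∈ Γ, ∀ x ∈ N, (α : MulAut K) x ∈ N) :
    ∀ α ∈ Γ, ∀ x : K, x ∈ N ↔ (α : MulAut K) x ∈ N := by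
  refine fun α hα x => ⟨h α hα x, fun hx => ?_⟩
  simpa using h α⁻¹ (inv_mem hα) _ hx

lemma DistalMod.comap (hN : DistalMod Γ N) {β : ↥(ContAut K)} (hβ : ∀ α ∈ Γ, β * α = α * β) :
    DistalMod Γ (N.comap (β : MulAut K).toMonoidHom) := by
  intro x hx
  obtain ⟨U, hU, h⟩ := hN _ hx
  refine ⟨(β : MulAut K) ⁻¹' U, (ContAut.continuous β).continuousAt.preimage_mem_nhds ?_, ?_⟩
  · simpa using hU
  · intro α hα m hm hmem
    have e : (β : MulAut K) ((α : MulAut K) x) = (α : MulAut K) ((β : MulAut K) x) :=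
      congrArg (fun γ : ↥(ContAut K) => (γ : MulAut K) x) (hβ α hα)
    rw [mem_preimage, map_mul, e] at hmem
    exact h α hα _ hm hmem

lemma DistalMod.sInf {F : Set (Subgroup K)} (hF : ∀ N ∈ F, DistalMod Γ N) :
    DistalMod Γ (sInf F) := by
  intro x hx
  simp only [Subgroup.mem_sInf, not_forall] at hx
  obtain ⟨N, hN, hxN⟩ := hx
  obtain ⟨U, hU, h⟩ := hF N hN x hxN
  exact ⟨U, hU, fun α hα m hm => h α hα m (Subgroup.mem_sInf.1 hm N hN)⟩

lemma DistalMod.normalCore [IsTopologicalGroup K] [CompactSpace K] (hN : DistalMod Γ N) :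
    DistalMod Γ N.normalCore := by
  intro x hx
  obtain ⟨k, hk⟩ : ∃ k, k * x * k⁻¹ ∉ N := by
    by_contra! h
    exact hx h
  obtain ⟨W, hW, h⟩ := hN _ hk
  have hU : ∀ᶠ y in 𝓝 (1 : K), ∀ g ∈ (univ : Set K), g * y * g⁻¹ ∈ W := by
    refine isCompact_univ.eventually_forall_of_forall_eventually fun g _ => ?_
    have hc : Continuous fun z : K × K => z.2 * z.1 * z.2⁻¹ := by fun_prop
    refine hc.continuousAt.preimage_mem_nhds ?_
    simpa using hW
  refine ⟨_, hU, fun α hα m hm hmem => ?_⟩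
  have hW' := hmem ((α : MulAut K) k) (mem_univ _)
  refine h α hα _ (hm ((α : MulAut K) k)) ?_
  convert hW' using 1
  simp only [map_mul, map_inv]
  group

lemma DistalMod.distalSet [IsTopologicalGroup K] [N.Normal] (hN : DistalMod Γ N)
    (hinv : ∀ α ∈ Γ, ∀ x : K, x ∈ N ↔ (α : MulAut K) x ∈ N) :
    DistalSet {q : ↥(ContAut (K ⧸ N)) | ∃ α, ∃ hα : α ∈ Γ, q = quotAut N α (hinv α hα)} := by
  intro q hq hcl
  obtain ⟨x, rfl⟩ := QuotientGroup.mk_surjective q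
  have hx : x ∉ N := fun hx => hq ((QuotientGroup.eq_one_iff x).2 hx)
  obtain ⟨U, hU, h⟩ := hN x hx
  have hV : (QuotientGroup.mk : K → K ⧸ N) '' U ∈ 𝓝 (1 : K ⧸ N) :=
    QuotientGroup.isOpenMap_coe.image_mem_nhds hU
  obtain ⟨_, ⟨u, hu, hux⟩, _, ⟨α, hα, rfl⟩, rfl⟩ := mem_closure_iff_nhds.1 hcl _ hV
  have hm : ((α : MulAut K) x)⁻¹ * u ∈ N := QuotientGroup.eq.1 hux.symm
  exact h α hα _ hm (by simpa using hu)

end Distal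

/-- A group acting ergodically by automorphisms has a dense orbit through almost every point. -/
lemma ae_dense_orbit {G : Type*} [Group G] [TopologicalSpace G] [SecondCountableTopology G]
    [MeasurableSpace G] [BorelSpace G] (ν : Measure G) [ν.IsOpenPosMeasure] [IsProbabilityMeasure ν]
    (Γ : Subgroup ↥(ContAut G)) (h : ErgSet ν (Γ : Set ↥(ContAut G))) :
    ∀ᵐ x ∂ν, Dense ((fun α : ↥(ContAut G) => (α : MulAut G) x) '' Γ) := by
  have hB := TopologicalSpace.isBasis_countableBasis G
  have key : ∀ U ∈ TopologicalSpace.countableBasis G,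
      ∀ᵐ x ∂ν, ∃ α ∈ Γ, (α : MulAut G) x ∈ U := by
    intro U hU
    have hUo := hB.isOpen hU
    set V : Set G := ⋃ α ∈ Γ, (α : MulAut G) ⁻¹' U with hV
    have hVo : IsOpen V :=
      isOpen_biUnion fun α _ => hUo.preimage (ContAut.continuous α)
    have hUV : U ⊆ V := fun x hx => mem_biUnion (one_mem Γ) hx
    have hne : ν V ≠ 0 :=
      (hVo.measure_pos ν ((TopologicalSpace.nonempty_of_mem_countableBasis hU).mono hUV)).ne'
    have hinv : ∀ α ∈ (Γ : Set ↥(ContAut G)), (α : MulAut G) '' V = V := by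
      intro α hα
      ext y
      simp only [hV, mem_image, mem_iUnion, mem_preimage, exists_prop]
      constructor
      · rintro ⟨x, ⟨γ, hγ, hx⟩, rfl⟩
        exact ⟨γ * α⁻¹, mul_mem hγ (inv_mem hα), by simpa using hx⟩
      · rintro ⟨γ, hγ, hy⟩
        exact ⟨(α : MulAut G).symm y, ⟨γ * α, mul_mem hγ hα, by simpa using hy⟩, by simp⟩
    have h1 := (h V hVo.measurableSet hinv).resolve_left hne
    filter_upwards [(prob_compl_eq_zero_iff hVo.measurableSet).2 h1 |> compl_mem_ae_iff.2] with x hx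
    simpa [hV] using hx
  filter_upwards [(ae_ball_iff (TopologicalSpace.countable_countableBasis G)).2 key] with x hx
  refine hB.dense_iff.2 fun U hU _ => ?_
  obtain ⟨α, hα, hxU⟩ := hx U hU
  exact ⟨_, hxU, α, hα, rfl⟩

section CompactGroup

variable {G : Type*} [Group G] [TopologicalSpace G] [IsTopologicalGroup G] [CompactSpace G]
  [MeasurableSpace G] [BorelSpace G]

lemma ContAut.measurePreserving (φ : ↥(ContAut G)) (ν : Measure G) [ν.IsHaarMeasure] :
    MeasurePreserving (φ : MulAut G) ν ν :=
  (φ : MulAut G).toMonoidHom.measurePreserving (ContAut.continuous φ)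
    (φ : MulAut G).surjective rfl

/-- The measure of the symmetric difference of `A` and its translate by `x` is unchanged when `x`
is moved by an automorphism preserving `A`. -/
lemma measure_smul_symmDiff_map (ν : Measure G) [ν.IsHaarMeasure] {A : Set G}
    (hA : MeasurableSet A) {φ : ↥(ContAut G)} (hφ : (φ : MulAut G) '' A = A) (x : G) :
    ν (((φ : MulAut G) x • A) ∆ A) = ν ((x • A) ∆ A) := by
  have hpre : (φ : MulAut G) ⁻¹' A = A := by
    conv_lhs => rw [← hφ]
    exact preimage_image_eq _ (φ : MulAut G).injective
  have hpre' : (φ : MulAut G) ⁻¹' ((φ : MulAut G) x • A) = x • A := by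
    ext y
    rw [mem_preimage, mem_smul_set_iff_inv_smul_mem, mem_smul_set_iff_inv_smul_mem, smul_eq_mul,
      smul_eq_mul, ← map_inv, ← map_mul, ← mem_preimage, hpre]
  rw [← (ContAut.measurePreserving φ ν).measure_preimage
    ((hA.const_smul _).symmDiff hA).nullMeasurableSet, preimage_symmDiff, hpre, hpre']

variable [TopologicalSpace.MetrizableSpace G]

lemma tendsto_measure_smul_symmDiff (ν : Measure G) [ν.IsHaarMeasure] {A : Set G}
    (hA : MeasurableSet A) :
    Filter.Tendsto (fun x : G => ν ((x • A) ∆ A)) (𝓝 1) (𝓝 0) := by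
  let f : C(G × G, G) := ⟨fun z => z.1⁻¹ * z.2, by fun_prop⟩
  have h := tendsto_measure_symmDiff_preimage_nhds_zero (μ := ν) (ν := ν)
    (f.curry.continuous.tendsto 1) (.of_forall fun x => measurePreserving_mul_left ν x⁻¹)
    (measurePreserving_mul_left ν 1⁻¹) hA.nullMeasurableSet (measure_ne_top _ _)
  refine h.congr fun x => ?_
  congr 2
  · ext y
    simp [f, mem_smul_set_iff_inv_smul_mem]
  · ext y
    simp [f]

lemma isClosed_aestabilizer (ν : Measure G) [ν.IsHaarMeasure] {A : Set G}
    (hA : MeasurableSet A) : IsClosed (MulAction.aestabilizer G ν A : Set G) := by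
  let f : C(G × G, G) := ⟨fun z => z.1⁻¹ * z.2, by fun_prop⟩
  have h := isClosed_setOfPred_preimage_ae_eq (μ := ν) (ν := ν) f.curry.continuous
    (fun x => measurePreserving_mul_left ν x⁻¹) A hA.nullMeasurableSet (measure_ne_top _ _)
  convert h using 1
  ext x
  have e : f.curry x ⁻¹' A = x • A := by
    ext y
    simp [f, mem_smul_set_iff_inv_smul_mem]
  simp [e]

lemma measure_eq_zero_or_one_of_aestabilizer_eq_top (ν : Measure G) [ν.IsHaarMeasure]
    [IsProbabilityMeasure ν] {A : Set G} (hA : MeasurableSet A)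
    (h : MulAction.aestabilizer G ν A = ⊤) : ν A = 0 ∨ ν A = 1 := by
  have hc := MulAction.aeconst_of_aestabilizer_eq_top G hA.nullMeasurableSet h
  rcases Filter.eventuallyConst_set'.1 hc with h | h
  · exact .inl (ae_eq_empty.1 h)
  · exact .inr (by rw [measure_congr h, measure_univ])

end CompactGroup

section Subgroup

variable [Group K] [TopologicalSpace K] [IsTopologicalGroup K] [CompactSpace K]
  [TopologicalSpace.MetrizableSpace K] [MeasurableSpace K] [BorelSpace K]
  {Γ : Subgroup ↥(ContAut K)}

/-- An invariant Borel subset of `L` that is neither null nor conull gives a proper closed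
subgroup of `L`, normal in `K` and invariant, modulo which the action is still distal. -/
lemma exists_lt_distalMod {L : Subgroup K} [L.Normal] (hcl : IsClosed (L : Set K))
    (hinv : ∀ α ∈ Γ, ∀ x : K, x ∈ L ↔ (α : MulAut K) x ∈ L) (hL : DistalMod Γ L)
    (ν : Measure ↥L) [ν.IsHaarMeasure] [IsProbabilityMeasure ν] {A : Set ↥L}
    (hA : MeasurableSet A)
    (hAinv : ∀ α (hα : α ∈ Γ), (restrictAut L α (hinv α hα) : MulAut ↥L) '' A = A)
    (h0 : ν A ≠ 0) (h1 : ν A ≠ 1) :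
    ∃ M < L, M.Normal ∧ IsClosed (M : Set K) ∧
      (∀ α ∈ Γ, ∀ x : K, x ∈ M ↔ (α : MulAut K) x ∈ M) ∧ DistalMod Γ M := by
  have : CompactSpace ↥L := isCompact_iff_compactSpace.1 hcl.isCompact
  have : TopologicalSpace.MetrizableSpace ↥L := IsEmbedding.subtypeVal.metrizableSpace
  let T : Subgroup ↥L := MulAction.aestabilizer ↥L ν A
  have hT : ∀ x : ↥L, x ∈ T ↔ ν ((x • A) ∆ A) = 0 := fun x =>
    MulAction.mem_aestabilizer.trans measure_symmDiff_eq_zero_iff.symm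
  have hTtop : T ≠ ⊤ := fun h =>
    (measure_eq_zero_or_one_of_aestabilizer_eq_top ν hA h).elim h0 h1
  let S : Subgroup K := T.map L.subtype
  have hSL : S ≤ L := Subgroup.map_subtype_le T
  have hmemS : ∀ x : ↥L, (x : K) ∈ S ↔ x ∈ T := fun x => by simp [S]
  have hScl : IsClosed (S : Set K) := by
    rw [Subgroup.coe_map]
    exact hcl.isClosedEmbedding_subtypeVal.isClosedMap _ (isClosed_aestabilizer ν hA)
  have hSinv : ∀ α ∈ Γ, ∀ x ∈ S, (α : MulAut K) x ∈ S := by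
    rintro α hα _ ⟨x, hx, rfl⟩
    refine (hmemS ((restrictAut L α (hinv α hα) : MulAut ↥L) x)).2 ((hT _).2 ?_)
    rw [measure_smul_symmDiff_map ν hA (hAinv α hα)]
    exact (hT x).1 hx
  have hSdist : DistalMod Γ S := by
    intro x hx
    by_cases hxL : x ∈ L
    · lift x to ↥L using hxL
      have hpos : 0 < ν ((x • A) ∆ A) :=
        pos_iff_ne_zero.2 fun h => hx ((hmemS x).2 ((hT x).2 h))
      have hV := (tendsto_measure_smul_symmDiff ν hA).eventually (gt_mem_nhds hpos)
      obtain ⟨W, hW, hWV⟩ := mem_nhds_subtype _ _ _ |>.1 hV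
      refine ⟨W, hW, ?_⟩
      rintro α hα _ ⟨m, hm, rfl⟩ hmem
      set y : ↥L := (restrictAut L α (hinv α hα) : MulAut ↥L) x with hy
      have hlt : ν (((y * m) • A) ∆ A) < ν ((x • A) ∆ A) := hWV (a := y * m) hmem
      have hym : ((y * m) • A : Set ↥L) =ᵐ[ν] y • A := by
        rw [mul_smul]
        exact (smul_set_ae_eq y).2 hm
      rw [measure_congr (hym.symmDiff (ae_eq_refl A)), hy,
        measure_smul_symmDiff_map ν hA (hAinv α hα)] at hlt
      exact hlt.false
    · obtain ⟨U, hU, h⟩ := hL x hxL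
      exact ⟨U, hU, fun α hα m hm => h α hα m (hSL hm)⟩
  refine ⟨S.normalCore, ?_, inferInstance, ?_, mem_iff_of_forall_mem ?_, hSdist.normalCore⟩
  · refine lt_of_le_of_ne (S.normalCore_le.trans hSL) fun h => hTtop (eq_top_iff.2 fun x _ => ?_)
    exact (hmemS x).1 (S.normalCore_le (h.ge x.2))
  · have : (S.normalCore : Set K) = ⋂ k : K, (fun x => k * x * k⁻¹) ⁻¹' S := by
      ext x
      simp [Subgroup.normalCore]
    rw [this]
    exact isClosed_iInter fun k => hScl.preimage (by fun_prop)
  · intro α hα x hx k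
    have := hSinv α hα _ (hx ((α : MulAut K).symm k))
    simpa using this

/-- A closed invariant subgroup with ergodic action is contained in every closed subgroup modulo
which the action is distal. -/
lemma le_of_ergSet_of_distalMod {L H : Subgroup K} (hL : IsClosed (L : Set K))
    (hdist : DistalMod Γ L) (hH : IsClosed (H : Set K))
    (hinv : ∀ α ∈ Γ, ∀ x : K, x ∈ H ↔ (α : MulAut K) x ∈ H)
    (herg : ∀ ν : Measure ↥H, ν.IsHaarMeasure → IsProbabilityMeasure ν →
      ErgSet ν {e | ∃ α, ∃ hα : α ∈ Γ, e = restrictAut H α (hinv α hα)}) : H ≤ L := by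
  have : CompactSpace ↥H := isCompact_iff_compactSpace.1 hH.isCompact
  have : TopologicalSpace.MetrizableSpace ↥H := IsEmbedding.subtypeVal.metrizableSpace
  let ν : Measure ↥H := Measure.haarMeasure ⊤
  have : IsProbabilityMeasure ν := ⟨by
    simpa using Measure.haarMeasure_self (K₀ := (⊤ : TopologicalSpace.PositiveCompacts ↥H))⟩
  let Δ : Subgroup ↥(ContAut ↥H) :=
    { carrier := {e | ∃ α, ∃ hα : α ∈ Γ, e = restrictAut H α (hinv α hα)}
      one_mem' := ⟨1, one_mem Γ, rfl⟩
      mul_mem' := by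
        rintro _ _ ⟨α, hα, rfl⟩ ⟨β, hβ, rfl⟩
        exact ⟨α * β, mul_mem hα hβ, rfl⟩
      inv_mem' := by
        rintro _ ⟨α, hα, rfl⟩
        exact ⟨α⁻¹, inv_mem hα, rfl⟩ }
  have hae : ∀ᵐ x : ↥H ∂ν, (x : K) ∈ L := by
    filter_upwards [ae_dense_orbit ν Δ (herg ν inferInstance inferInstance)] with x hx
    by_contra hxL
    obtain ⟨U, hU, h⟩ := hdist _ hxL
    have hU' : (Subtype.val : ↥H → K) ⁻¹' U ∈ 𝓝 (1 : ↥H) :=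
      continuous_subtype_val.continuousAt.preimage_mem_nhds hU
    obtain ⟨_, hy, _, ⟨α, hα, rfl⟩, rfl⟩ := mem_closure_iff_nhds.1 (hx 1) _ hU'
    exact h α hα 1 (one_mem L) (by simpa using hy)
  have hdense : Dense ((Subtype.val : ↥H → K) ⁻¹' L) := Measure.dense_of_ae hae
  have huniv := (hL.preimage (continuous_subtype_val (p := (· ∈ H)))).closure_eq ▸ hdense.closure_eq
  intro x hx
  exact huniv.ge (mem_univ (⟨x, hx⟩ : ↥H))

end Subgroup

/-- Proposition 2.1: largest ergodic subgroup. For a group `Γ` of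
continuous automorphisms of a compact metrizable group `K` there is a largest closed
normal `Γ`-invariant subgroup `L`, invariant under the centre `Z(Γ)` of the action,
such that `Γ` is ergodic on `L` and distal on `K / L`; every closed `Γ`-invariant
subgroup on which `Γ` is ergodic is contained in `L`. -/
theorem statement4 {K : Type*} [Group K] [TopologicalSpace K] [IsTopologicalGroup K]
    [CompactSpace K] [TopologicalSpace.MetrizableSpace K]
    [MeasurableSpace K] [BorelSpace K]
    (Γ : Subgroup ↥(ContAut K)) :
    ∃ (L : Subgroup K) (hn : L.Normal) (hcl : IsClosed (L : Set K))
      (hinv : ∀ α ∈ Γ, ∀ x : K, x ∈ L ↔ (α : MulAut K) x ∈ L),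
      haveI := hn
      (∀ β : ↥(ContAut K), (∀ α ∈ Γ, β * α = α * β) →
        ∀ x : K, x ∈ L ↔ (β : MulAut K) x ∈ L)
      ∧ (∀ ν : Measure ↥L, ν.IsHaarMeasure → IsProbabilityMeasure ν →
          ErgSet ν {e | ∃ α, ∃ hα : α ∈ Γ, e = restrictAut L α (hinv α hα)})
      ∧ DistalSet {q : ↥(ContAut (K ⧸ L)) | ∃ α, ∃ hα : α ∈ Γ, q = quotAut L α (hinv α hα)}
      ∧ (∀ H : Subgroup K, IsClosed (H : Set K) →
          ∀ hH : ∀ α ∈ Γ, ∀ x : K, x ∈ H ↔ (α : MulAut K) x ∈ H,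
          (∀ ν : Measure ↥H, ν.IsHaarMeasure → IsProbabilityMeasure ν →
            ErgSet ν {e | ∃ α, ∃ hα : α ∈ Γ, e = restrictAut H α (hH α hα)}) → H ≤ L) := by
  let F : Set (Subgroup K) := {N | N.Normal ∧ IsClosed (N : Set K) ∧
    (∀ α ∈ Γ, ∀ x : K, x ∈ N ↔ (α : MulAut K) x ∈ N) ∧ DistalMod Γ N}
  have hn : (sInf F).Normal := ⟨fun x hx g => Subgroup.mem_sInf.2 fun N hN =>
    hN.1.conj_mem x (Subgroup.mem_sInf.1 hx N hN) g⟩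
  have hcl : IsClosed ((sInf F : Subgroup K) : Set K) := by
    rw [Subgroup.coe_sInf]
    exact isClosed_biInter fun N hN => hN.2.1
  have hinv : ∀ α ∈ Γ, ∀ x : K, x ∈ sInf F ↔ (α : MulAut K) x ∈ sInf F := by
    intro α hα x
    simp only [Subgroup.mem_sInf]
    exact forall₂_congr fun N hN => hN.2.2.1 α hα x
  have hdist : DistalMod Γ (sInf F) := DistalMod.sInf fun N hN => hN.2.2.2
  have hcenter : ∀ β : ↥(ContAut K), (∀ α ∈ Γ, β * α = α * β) →
      ∀ x ∈ sInf F, (β : MulAut K) x ∈ sInf F := by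
    intro β hβ x hx
    refine Subgroup.mem_sInf.2 fun N hN => ?_
    refine Subgroup.mem_sInf.1 hx (N.comap (β : MulAut K).toMonoidHom)
      ⟨hN.1.comap _, hN.2.1.preimage (ContAut.continuous β), fun α hα y => ?_,
        hN.2.2.2.comap hβ⟩
    have e : (β : MulAut K) ((α : MulAut K) y) = (α : MulAut K) ((β : MulAut K) y) :=
      congrArg (fun γ : ↥(ContAut K) => (γ : MulAut K) y) (hβ α hα)
    change (β : MulAut K) y ∈ N ↔ (β : MulAut K) ((α : MulAut K) y) ∈ N
    rw [e]
    exact hN.2.2.1 α hα _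
  refine ⟨sInf F, hn, hcl, hinv, fun β hβ x => ⟨hcenter β hβ x, fun hx => ?_⟩, ?_,
    hdist.distalSet hinv, fun H hHcl hH herg => le_of_ergSet_of_distalMod hcl hdist hHcl hH herg⟩
  · have hβ' : ∀ α ∈ Γ, β⁻¹ * α = α * β⁻¹ := fun α hα =>
      (Commute.inv_left (hβ α hα : Commute β α)).eq
    simpa using hcenter β⁻¹ hβ' _ hx
  · intro ν hν hprob A hA hAinv
    by_contra! h
    obtain ⟨M, hlt, hM⟩ := exists_lt_distalMod hcl hinv hdist ν hA
      (fun α hα => hAinv _ ⟨α, hα, rfl⟩) h.1 h.2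
    exact hlt.not_ge (sInf_le hM)

end ErgZd
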